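/- The operator X acts tridiagonally on the rational functions of Hahn type: for every integer n with 1 ≤ n ≤ N − 1 and every integer x, (x − α) U_n(x;α,β,N) − x U_n(x−1;α,β,N) = μ₁ U_{n+1}(x;α,β,N) + μ₂ U_n(x;α,β,N) + μ₃ U_{n−1}(x;α,β,N), where μ₁ = n(β+n+1)(N−β−n)/((N−β−2n)(N−β−2n−1)), μ₂ = −α − n + (βn(n−1) + n²(n−1))/(N−β−2n+1) − (βn(n+1) + n(n+1)²)/(N−β−2n−1), and μ₃ = n(N−β−n)(N−n+1)/((N−β−2n)(N−β−2n+1)). -/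

import Mathlib

/-- Pochhammer symbol `(a)_k = a (a+1) ⋯ (a+k-1)`, with `(a)_0 = 1`. -/
noncomputable def poch (a : ℝ) (k : ℕ) : ℝ := ∏ i ∈ Finset.range k, (a + (i : ℝ))

/-- The rational function of Hahn type `U_n(x;α,β,N)`. -/
noncomputable def U (α β : ℝ) (N n : ℕ) (x : ℤ) : ℝ :=
  ((-1 : ℝ) ^ n * poch (-(N : ℝ)) n / poch (β + 1) n) *
    ∑ k ∈ Finset.range (n + 1),
      poch (-(x : ℝ)) k * poch (-(n : ℝ)) k * poch (β + (n : ℝ) - (N : ℝ)) k /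
        ((Nat.factorial k : ℝ) * poch (-(N : ℝ)) k * poch (α - (x : ℝ)) k)

/-- Recurrence coefficients. -/
noncomputable def mu1 (α β : ℝ) (N n : ℕ) : ℝ :=
  (n : ℝ) * (β + (n : ℝ) + 1) * ((N : ℝ) - β - (n : ℝ)) /
    (((N : ℝ) - β - 2 * (n : ℝ)) * ((N : ℝ) - β - 2 * (n : ℝ) - 1))

noncomputable def mu2 (α β : ℝ) (N n : ℕ) : ℝ :=
  -α - (n : ℝ)
    + (β * (n : ℝ) * ((n : ℝ) - 1) + (n : ℝ) ^ 2 * ((n : ℝ) - 1)) /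
        ((N : ℝ) - β - 2 * (n : ℝ) + 1)
    - (β * (n : ℝ) * ((n : ℝ) + 1) + (n : ℝ) * ((n : ℝ) + 1) ^ 2) /
        ((N : ℝ) - β - 2 * (n : ℝ) - 1)

noncomputable def mu3 (α β : ℝ) (N n : ℕ) : ℝ :=
  (n : ℝ) * ((N : ℝ) - β - (n : ℝ)) * ((N : ℝ) - (n : ℝ) + 1) /
    (((N : ℝ) - β - 2 * (n : ℝ)) * ((N : ℝ) - β - 2 * (n : ℝ) + 1))

noncomputable def mu7 (α β : ℝ) (N n : ℕ) : ℝ :=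
  -((β + (n : ℝ) + 1) * ((N : ℝ) - β - (n : ℝ))) /
    (((N : ℝ) - β - 2 * (n : ℝ)) * ((N : ℝ) - β - 2 * (n : ℝ) - 1))

noncomputable def mu8 (α β : ℝ) (N n : ℕ) : ℝ :=
  (((n : ℝ) + 1) * β + ((n : ℝ) + 1) ^ 2) / ((N : ℝ) - β - 2 * (n : ℝ) - 1)
    - (β * (n : ℝ) + (n : ℝ) ^ 2) / ((N : ℝ) - β - 2 * (n : ℝ) + 1)

noncomputable def mu9 (α β : ℝ) (N n : ℕ) : ℝ :=
  -((n : ℝ) * ((N : ℝ) - (n : ℝ) + 1)) /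
    (((N : ℝ) - β - 2 * (n : ℝ)) * ((N : ℝ) - β - 2 * (n : ℝ) + 1))

theorem poch_zero (a : ℝ) : poch a 0 = 1 := by simp [poch]

theorem poch_succ (a : ℝ) (k : ℕ) : poch a (k + 1) = poch a k * (a + k) := by
  simp [poch, Finset.prod_range_succ]

theorem poch_succ_left (a : ℝ) (k : ℕ) : poch a (k + 1) = a * poch (a + 1) k := by
  unfold poch
  rw [Finset.prod_range_succ', mul_comm]
  congr 1
  · simp
  · refine Finset.prod_congr rfl fun i _ => ?_
    push_cast
    ring

theorem poch_ne_zero {a : ℝ} (ha : ∀ m : ℤ, a ≠ m) (k : ℕ) : poch a k ≠ 0 := by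
  refine Finset.prod_ne_zero_iff.2 fun i _ h => ha (-(i : ℤ)) ?_
  push_cast
  linarith

theorem poch_neg_natCast_eq_zero {n k : ℕ} (h : n < k) : poch (-(n : ℝ)) k = 0 :=
  Finset.prod_eq_zero (Finset.mem_range.2 h) (by ring)

theorem poch_neg_natCast_ne_zero {n k : ℕ} (h : k ≤ n) : poch (-(n : ℝ)) k ≠ 0 := by
  refine Finset.prod_ne_zero_iff.2 fun i hi h0 => ?_
  have hi' : i < n := (Finset.mem_range.1 hi).trans_le h
  have : (i : ℝ) < n := by exact_mod_cast hi'
  linarith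

/-- The prefactor of `U α β N n`. -/
noncomputable def hahnPrefactor (β : ℝ) (N n : ℕ) : ℝ :=
  (-1 : ℝ) ^ n * poch (-(N : ℝ)) n / poch (β + 1) n

theorem hahnPrefactor_succ {β : ℝ} (N n : ℕ) :
    hahnPrefactor β N (n + 1) = hahnPrefactor β N n * ((N - n) / (β + 1 + n)) := by
  unfold hahnPrefactor
  rw [poch_succ, poch_succ, pow_succ, div_mul_div_comm]
  ring

/-- The coefficient of `(-x)_k / (α - x)_k` in `U α β N n x`. -/
noncomputable def hahnCoeff (β : ℝ) (N n k : ℕ) : ℝ :=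
  hahnPrefactor β N n * (poch (-(n : ℝ)) k * poch (β + n - N) k /
    ((Nat.factorial k : ℝ) * poch (-(N : ℝ)) k))

/-- The basis function `(-x)_k / (α - x)_k`. -/
noncomputable def pochRatio (α : ℝ) (k : ℕ) (x : ℝ) : ℝ := poch (-x) k / poch (α - x) k

theorem U_eq_sum_of_lt (α β : ℝ) (N : ℕ) {n M : ℕ} (h : n < M) (x : ℤ) :
    U α β N n x = ∑ k ∈ Finset.range M, hahnCoeff β N n k * pochRatio α k x := by
  have hsub : Finset.range (n + 1) ⊆ Finset.range M := Finset.range_subset_range.2 h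
  rw [← Finset.sum_subset hsub]
  · rw [U, Finset.mul_sum]
    refine Finset.sum_congr rfl fun k _ => ?_
    simp only [hahnCoeff, hahnPrefactor, pochRatio, div_eq_mul_inv, mul_inv]
    ring
  · intro k _ hk
    have : n < k := by simpa using hk
    simp [hahnCoeff, poch_neg_natCast_eq_zero this]

theorem pochRatio_shift {α x : ℝ} (h : ∀ m : ℤ, α - x ≠ m) (k : ℕ) :
    (x - α) * pochRatio α k x - x * pochRatio α k (x - 1) =
      (k - α) * pochRatio α k x - k * pochRatio α (k + 1) x := by
  have h1 : α - x ≠ 0 := by simpa using h 0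
  have h2 : α - x + k ≠ 0 := fun h0 => h (-(k : ℤ)) (by push_cast; linarith)
  have h3 := poch_ne_zero h k
  have hshift : x * pochRatio α k (x - 1) = -((α - x) * pochRatio α (k + 1) x) := by
    unfold pochRatio
    rw [poch_succ_left, poch_succ_left, show -(x - 1) = -x + 1 by ring,
      show α - (x - 1) = α - x + 1 by ring, mul_div_mul_comm, ← mul_assoc, mul_div_cancel₀ _ h1]
    ring
  have hsucc : (α - x + k) * pochRatio α (k + 1) x = (k - x) * pochRatio α k x := by
    unfold pochRatio
    rw [poch_succ, poch_succ]
    field_simp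
    ring
  rw [hshift]
  linear_combination hsucc

/-- The three-term relation between the coefficients, shifted by one in both indices. -/
theorem hahnCoeff_recurrence (α : ℝ) {β : ℝ} {N : ℕ} (hβ : ∀ m : ℤ, β ≠ m) (n k : ℕ)
    (hn : n + 2 ≤ N) (hk : k + 1 ≤ n + 2) :
    ((k + 1 : ℕ) - α) * hahnCoeff β N (n + 1) (k + 1) - k * hahnCoeff β N (n + 1) k =
      mu1 α β N (n + 1) * hahnCoeff β N (n + 2) (k + 1)
        + mu2 α β N (n + 1) * hahnCoeff β N (n + 1) (k + 1)
        + mu3 α β N (n + 1) * hahnCoeff β N n (k + 1) := by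
  have d0 : (N : ℝ) - β - 2 * (n + 1) ≠ 0 := fun h => hβ (N - 2 * (n + 1)) (by push_cast; linarith)
  have d1 : (N : ℝ) - β - 2 * (n + 1) - 1 ≠ 0 :=
    fun h => hβ (N - 2 * (n + 1) - 1) (by push_cast; linarith)
  have d2 : (N : ℝ) - β - 2 * (n + 1) + 1 ≠ 0 :=
    fun h => hβ (N - 2 * (n + 1) + 1) (by push_cast; linarith)
  have e0 : β + 1 + n ≠ 0 := fun h => hβ (-1 - n) (by push_cast; linarith)
  have e1 : β + 1 + (n + 1) ≠ 0 := fun h => hβ (-1 - (n + 1)) (by push_cast; linarith)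
  obtain ⟨D, hD⟩ : ∃ D : ℝ, D = N - β - 2 * (n + 1) := ⟨_, rfl⟩
  obtain ⟨E, hE⟩ : ∃ E : ℝ, E = β + 1 + n := ⟨_, rfl⟩
  have hE1 : β + 1 + ((n : ℝ) + 1) = E + 1 := by rw [hE]; ring
  have hN : (N : ℝ) = D + E + n + 1 := by rw [hD, hE]; ring
  have hB : β = E - 1 - n := by rw [hE]; ring
  rw [← hD] at d0 d1 d2
  rw [← hE] at e0
  rw [hE1] at e1
  have hp := poch_neg_natCast_ne_zero (hk.trans hn)
  rw [poch_succ] at hp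
  obtain ⟨hp0, hp1⟩ := mul_ne_zero_iff.1 hp
  rcases k with _ | k
  · simp only [hahnCoeff, hahnPrefactor_succ, poch_succ, poch_zero, mu1, mu2, mu3]
    generalize hahnPrefactor β N n = A
    push_cast at hp1 ⊢
    simp only [Nat.factorial, Nat.cast_one, add_zero, one_mul, mul_one] at hp1 ⊢
    rw [← hD, ← hE, hE1]
    have hN0 : (N : ℝ) ≠ 0 := by simpa using hp1
    rw [hN] at hN0 ⊢
    rw [hB]
    field_simp
    ring
  · have pn2 : poch (-((n + 2 : ℕ) : ℝ)) (k + 2) = (n + 2) * (n + 1) * poch (-(n : ℝ)) k := by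
      rw [poch_succ_left, poch_succ_left]
      push_cast
      rw [show -((n : ℝ) + 2) + 1 + 1 = -n by ring]
      ring
    have pn1 : poch (-((n + 1 : ℕ) : ℝ)) (k + 1) = -(n + 1) * poch (-(n : ℝ)) k := by
      rw [poch_succ_left]
      push_cast
      rw [show -((n : ℝ) + 1) + 1 = -n by ring]
    have qn2 : poch (β + (n + 1 : ℕ) - N) (k + 1) =
        (β + (n + 1) - N) * poch (β + (n + 2 : ℕ) - N) k := by
      rw [poch_succ_left]
      push_cast
      rw [show β + ((n : ℝ) + 1) - N + 1 = β + (n + 2) - N by ring]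
    have qn : poch (β + (n : ℕ) - N) (k + 2) =
        (β + n - N) * (β + (n + 1) - N) * poch (β + (n + 2 : ℕ) - N) k := by
      rw [poch_succ_left, poch_succ_left,
        show β + (n : ℝ) - N + 1 + 1 = β + (n + 2 : ℕ) - N by push_cast; ring]
      ring
    simp only [hahnCoeff, hahnPrefactor_succ, mu1, mu2, mu3]
    rw [pn2, qn, poch_succ (-((n + 1 : ℕ) : ℝ)) (k + 1), pn1,
      poch_succ (β + (n + 1 : ℕ) - N) (k + 1), qn2, poch_succ (-(n : ℝ)) (k + 1),
      poch_succ (-(n : ℝ)) k, poch_succ (β + (n + 2 : ℕ) - N) (k + 1),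
      poch_succ (β + (n + 2 : ℕ) - N) k, poch_succ (-(N : ℝ)) (k + 1), Nat.factorial_succ (k + 1),
      Nat.cast_mul]
    generalize hahnPrefactor β N n = A
    generalize poch (-(n : ℝ)) k = P
    generalize poch (β + (n + 2 : ℕ) - N) k = Q
    have hf : (Nat.factorial (k + 1) : ℝ) ≠ 0 := by positivity
    generalize (Nat.factorial (k + 1) : ℝ) = F at *
    generalize poch (-(N : ℝ)) (k + 1) = R at *
    have hk0 : (k : ℝ) + 1 + 1 ≠ 0 := by positivity
    push_cast at hp1 ⊢
    rw [← hD, ← hE, hE1]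
    obtain ⟨S, hS⟩ : ∃ S : ℝ, S = -(N : ℝ) + (k + 1) := ⟨_, rfl⟩
    obtain ⟨T, hT⟩ : ∃ T : ℝ, T = (k : ℝ) + 1 + 1 := ⟨_, rfl⟩
    rw [← hS] at hp1 ⊢
    rw [← hT] at hk0 ⊢
    have hK : (k : ℝ) = T - 2 := by rw [hT]; ring
    have hm : (n : ℝ) = T - 2 - D - E - S := by rw [hS, hN, hT]; ring
    rw [hN, hB, hm, hK]
    clear * - d0 d1 d2 e0 e1 hp0 hp1 hf hk0
    field_simp
    ring

theorem hahnCoeff_recurrence_zero (α : ℝ) {β : ℝ} {N : ℕ} (hβ : ∀ m : ℤ, β ≠ m) (n : ℕ) :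
    -α * hahnCoeff β N (n + 1) 0 =
      mu1 α β N (n + 1) * hahnCoeff β N (n + 2) 0
        + mu2 α β N (n + 1) * hahnCoeff β N (n + 1) 0
        + mu3 α β N (n + 1) * hahnCoeff β N n 0 := by
  have d0 : (N : ℝ) - β - 2 * (n + 1) ≠ 0 := fun h => hβ (N - 2 * (n + 1)) (by push_cast; linarith)
  have d1 : (N : ℝ) - β - 2 * (n + 1) - 1 ≠ 0 :=
    fun h => hβ (N - 2 * (n + 1) - 1) (by push_cast; linarith)
  have d2 : (N : ℝ) - β - 2 * (n + 1) + 1 ≠ 0 :=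
    fun h => hβ (N - 2 * (n + 1) + 1) (by push_cast; linarith)
  have e0 : β + 1 + n ≠ 0 := fun h => hβ (-1 - n) (by push_cast; linarith)
  have e1 : β + 1 + (n + 1) ≠ 0 := fun h => hβ (-1 - (n + 1)) (by push_cast; linarith)
  obtain ⟨D, hD⟩ : ∃ D : ℝ, D = N - β - 2 * (n + 1) := ⟨_, rfl⟩
  obtain ⟨E, hE⟩ : ∃ E : ℝ, E = β + 1 + n := ⟨_, rfl⟩
  have hE1 : β + 1 + ((n : ℝ) + 1) = E + 1 := by rw [hE]; ring
  have hN : (N : ℝ) = D + E + n + 1 := by rw [hD, hE]; ring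
  have hB : β = E - 1 - n := by rw [hE]; ring
  rw [← hD] at d0 d1 d2
  rw [← hE] at e0
  rw [hE1] at e1
  simp only [hahnCoeff, hahnPrefactor_succ, poch_zero, mu1, mu2, mu3]
  generalize hahnPrefactor β N n = A
  push_cast
  rw [← hD, ← hE, hE1, hN, hB]
  field_simp
  ring

theorem statement11 (N : ℕ) (hN : 0 < N) (α β : ℝ)
    (hα : ∀ m : ℤ, α ≠ (m : ℝ)) (hβ : ∀ m : ℤ, β ≠ (m : ℝ))
    (n : ℕ) (hn1 : 1 ≤ n) (hn2 : n + 1 ≤ N) (x : ℤ) :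
    ((x : ℝ) - α) * U α β N n x - (x : ℝ) * U α β N n (x - 1) =
      mu1 α β N n * U α β N (n + 1) x + mu2 α β N n * U α β N n x
        + mu3 α β N n * U α β N (n - 1) x := by
  obtain ⟨n, rfl⟩ := Nat.exists_eq_add_of_le' hn1
  have hx : ∀ m : ℤ, α - x ≠ m := fun m h => hα (m + x) (by push_cast; linarith)
  rw [U_eq_sum_of_lt α β N (n := n + 1) (M := n + 3) (by lia) x,
    U_eq_sum_of_lt α β N (n := n + 1) (M := n + 3) (by lia) (x - 1)]
  have hL : ((x : ℝ) - α) * ∑ k ∈ Finset.range (n + 3), hahnCoeff β N (n + 1) k * pochRatio α k x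
      - x * ∑ k ∈ Finset.range (n + 3), hahnCoeff β N (n + 1) k * pochRatio α k ((x - 1 : ℤ) : ℝ)
      = ∑ k ∈ Finset.range (n + 3), (k - α) * hahnCoeff β N (n + 1) k * pochRatio α k x
        - ∑ k ∈ Finset.range (n + 3), k * hahnCoeff β N (n + 1) k * pochRatio α (k + 1) x := by
    rw [Finset.mul_sum, Finset.mul_sum, ← Finset.sum_sub_distrib, ← Finset.sum_sub_distrib]
    refine Finset.sum_congr rfl fun k _ => ?_
    push_cast
    linear_combination hahnCoeff β N (n + 1) k * pochRatio_shift hx k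
  have hlast : hahnCoeff β N (n + 1) (n + 2) = 0 := by
    rw [hahnCoeff, poch_neg_natCast_eq_zero (Nat.lt_succ_self (n + 1))]
    simp
  rw [hL, Nat.add_sub_cancel, U_eq_sum_of_lt α β N (n := n + 1 + 1) (M := n + 3) (by lia) x,
    U_eq_sum_of_lt α β N (n := n) (M := n + 3) (by lia) x,
    Finset.mul_sum, Finset.mul_sum, Finset.mul_sum, ← Finset.sum_add_distrib,
    ← Finset.sum_add_distrib, Finset.sum_range_succ' _ (n + 2),
    Finset.sum_range_succ _ (n + 2), hlast, mul_zero, zero_mul, add_zero,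
    Finset.sum_range_succ' _ (n + 2), add_sub_right_comm, ← Finset.sum_sub_distrib]
  congr 1
  · refine Finset.sum_congr rfl fun k hk => ?_
    have hk' : k < n + 2 := Finset.mem_range.1 hk
    linear_combination pochRatio α (k + 1) x * hahnCoeff_recurrence α hβ n k hn2 hk'
  · rw [Nat.cast_zero, zero_sub]
    linear_combination pochRatio α 0 x * hahnCoeff_recurrence_zero (N := N) α hβ n
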